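/- arXiv:1801.00391 — 2 statements merged into one kernel-verified Lean document; each statement's English description precedes it below -/
import Mathlib

section
/- Let V : ℝ → ℝ be continuous, 1-periodic, with max_{ℝ} V = 0 and V(y) ≤ −1 for all y ∈ [−1/3, 1/3]. Then for every ε ∈ (0,1) and every absolutely continuous η : [0, 1/ε] → ℝ with η(0) = 0, one has ∫₀^{1/ε} ( (1/2)|η′(t)|² − V(η(t)) ) dt ≥ 1/6, where the integral of the nonnegative integrand is interpreted in [0,+∞]. In particular, the value u^ε(0,1) := inf { ε·∫₀^{1/ε} ( (1/2)|η′(t)|² − V(η(t)) ) dt : η : [0,1/ε] → ℝ absolutely continuous, η(0) = 0 } satisfies u^ε(0,1) ≥ ε/6. -/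
open MeasureTheory Set
open scoped ENNReal NNReal

noncomputable section

/-- The action of an absolutely continuous curve `η(t) = ∫₀ᵗ η′`, computed in `[0,+∞]`
(the integrand `(1/2)|η′|² − V(η)` is nonnegative since `V ≤ 0`). -/
def action (V : ℝ → ℝ) (T : ℝ) (η η' : ℝ → ℝ) : ℝ≥0∞ :=
  ∫⁻ t in Set.Icc (0:ℝ) T, ENNReal.ofReal ((1/2) * (η' t) ^ 2 - V (η t))

theorem le_action_of_forall_mem {V : ℝ → ℝ} (hV : ∀ y ∈ Set.Icc (-(1/3) : ℝ) (1/3), V y ≤ -1)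
    {T : ℝ} (hT : 1 ≤ T) {η η' : ℝ → ℝ} (hη' : IntervalIntegrable η' volume 0 T)
    (hη : ∀ t ∈ Set.Icc (0:ℝ) T, η t = ∫ s in (0:ℝ)..t, η' s) :
    ENNReal.ofReal (1/3) ≤ action V T η η' := by
  have hT0 : (0:ℝ) ≤ T := zero_le_one.trans hT
  have hcont : ContinuousOn η (Icc 0 1) := by
    have h := intervalIntegral.continuousOn_primitive_interval' hη' left_mem_uIcc
    rw [uIcc_of_le hT0] at h
    exact (h.congr hη).mono (Icc_subset_Icc_right hT)
  by_cases hexit : ∃ t ∈ Icc (0:ℝ) 1, 1/3 ≤ |η t|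
  · obtain ⟨τ, ⟨⟨hτ0, hτ1⟩, hτ⟩, hmin⟩ : ∃ τ, IsLeast (Icc (0:ℝ) 1 ∩ (fun t => |η t|) ⁻¹' Ici (1/3)) τ := by
      apply IsCompact.exists_isLeast
      · exact isCompact_Icc.of_isClosed_subset
          (hcont.abs.preimage_isClosed_of_isClosed isClosed_Icc isClosed_Ici) inter_subset_left
      · obtain ⟨t, ht, h⟩ := hexit
        exact ⟨t, ht, h⟩
    calc ENNReal.ofReal (1/3) ≤ ENNReal.ofReal |η τ| := ENNReal.ofReal_le_ofReal hτ
      _ = ‖∫ s in Ioc 0 τ, η' s‖ₑ := by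
        rw [hη τ ⟨hτ0, hτ1.trans hT⟩, intervalIntegral.integral_of_le hτ0, Real.enorm_eq_ofReal_abs]
      _ ≤ ∫⁻ s in Ioc 0 τ, ‖η' s‖ₑ := enorm_integral_le_lintegral_enorm _
      _ = ∫⁻ s in Ioo 0 τ, ‖η' s‖ₑ := by rw [restrict_Ioo_eq_restrict_Ioc]
      _ ≤ ∫⁻ s in Ioo 0 τ, ENNReal.ofReal ((1/2) * (η' s) ^ 2 - V (η s)) := by
        refine setLIntegral_mono' measurableSet_Ioo fun s hs => ?_
        rw [Real.enorm_eq_ofReal_abs]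
        apply ENNReal.ofReal_le_ofReal
        have hlt : |η s| < 1/3 := by
          by_contra! h
          exact hs.2.not_ge (hmin ⟨⟨hs.1.le, hs.2.le.trans hτ1⟩, h⟩)
        have := hV (η s) (abs_le.mp hlt.le)
        nlinarith [sq_nonneg (|η' s| - 1), sq_abs (η' s)]
      _ ≤ action V T η η' := lintegral_mono_set fun s hs => ⟨hs.1.le, hs.2.le.trans (hτ1.trans hT)⟩
  · push Not at hexit
    calc ENNReal.ofReal (1/3) ≤ ENNReal.ofReal 1 := ENNReal.ofReal_le_ofReal (by norm_num)
      _ = ∫⁻ _ in Icc (0:ℝ) 1, 1 := by simp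
      _ ≤ ∫⁻ s in Icc (0:ℝ) 1, ENNReal.ofReal ((1/2) * (η' s) ^ 2 - V (η s)) := by
        refine setLIntegral_mono' measurableSet_Icc fun s hs => ?_
        rw [ENNReal.one_le_ofReal]
        have := hV (η s) (abs_le.mp (hexit s hs).le)
        nlinarith [sq_nonneg (η' s)]
      _ ≤ action V T η η' := lintegral_mono_set (Icc_subset_Icc_right hT)

theorem stmt16 (V : ℝ → ℝ) (hVcont : Continuous V) (hVper : Function.Periodic V 1)
    (hVmax : IsGreatest (Set.range V) 0)
    (hVle : ∀ y ∈ Set.Icc (-(1/3) : ℝ) (1/3), V y ≤ -1) :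
    ∀ ε : ℝ, ε ∈ Set.Ioo (0:ℝ) 1 →
      -- every absolutely continuous η with η(0) = 0 has action at least 1/6 ...
      (∀ η η' : ℝ → ℝ, IntervalIntegrable η' volume 0 ε⁻¹ →
        (∀ t ∈ Set.Icc (0:ℝ) ε⁻¹, η t = ∫ s in (0:ℝ)..t, η' s) →
        ENNReal.ofReal (1/6) ≤ action V ε⁻¹ η η') ∧
      -- ... and in particular u^ε(0,1) ≥ ε/6
      ε / 6 ≤ sInf {r : ℝ | ∃ η η' : ℝ → ℝ, IntervalIntegrable η' volume 0 ε⁻¹ ∧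
        (∀ t ∈ Set.Icc (0:ℝ) ε⁻¹, η t = ∫ s in (0:ℝ)..t, η' s) ∧
        action V ε⁻¹ η η' ≠ ⊤ ∧
        r = ε * (action V ε⁻¹ η η').toReal} := by
  intro ε hε
  have hlow : ∀ η η' : ℝ → ℝ, IntervalIntegrable η' volume 0 ε⁻¹ →
      (∀ t ∈ Set.Icc (0:ℝ) ε⁻¹, η t = ∫ s in (0:ℝ)..t, η' s) →
      ENNReal.ofReal (1/6) ≤ action V ε⁻¹ η η' := fun η η' hη' hη =>
    (ENNReal.ofReal_le_ofReal (by norm_num)).trans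
      (le_action_of_forall_mem hVle ((one_le_inv₀ hε.1).mpr hε.2.le) hη' hη)
  refine ⟨hlow, le_csInf ?_ ?_⟩
  · refine ⟨_, 0, 0, intervalIntegrable_const, by simp, ?_, rfl⟩
    simp [action, ENNReal.mul_eq_top]
  · rintro r ⟨η, η', hη', hη, hfin, rfl⟩
    have h := (ENNReal.ofReal_le_iff_le_toReal hfin).mp (hlow η η' hη' hη)
    nlinarith [mul_le_mul_of_nonneg_left h hε.1.le]
end
end

section
/- Let F : ℝ → ℝ be continuous, 1-periodic, and strictly positive, and set A = ∫₀¹ (1/F(x)) dx. Let ξ : (−∞, 0] → ℝ be differentiable with ξ(0) = 0 and ξ′(t) = F(ξ(t)) for all t ≤ 0. Then for every t < 0, | ξ(t)/t − 1/A | ≤ 1/|t|. -/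
open MeasureTheory

/-- A primitive of a continuous, positive, `1`-periodic function stays within one period integral
of the linear function with the same mean slope. -/
theorem abs_integral_sub_mul_le_of_periodic {g : ℝ → ℝ} (hg : Continuous g)
    (hper : Function.Periodic g 1) (hpos : ∀ x, 0 < g x) (y : ℝ) :
    |(∫ x in (0:ℝ)..y, g x) - y * ∫ x in (0:ℝ)..1, g x| ≤ ∫ x in (0:ℝ)..1, g x := by
  have hint : ∀ a b, IntervalIntegrable g volume a b := fun a b => hg.intervalIntegrable a b
  have hA : 0 < ∫ x in (0:ℝ)..1, g x :=
    intervalIntegral.intervalIntegral_pos_of_pos (hint 0 1) hpos one_pos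
  have hmono : ∀ {a b : ℝ}, a ≤ b → ∫ x in (0:ℝ)..a, g x ≤ ∫ x in (0:ℝ)..b, g x := by
    intro a b hab
    have hadd := intervalIntegral.integral_add_adjacent_intervals (hint 0 a) (hint a b)
    have hnonneg := intervalIntegral.integral_nonneg_of_forall (μ := volume) hab
      fun x => (hpos x).le
    linarith
  have hZ : ∀ n : ℤ, ∫ x in (0:ℝ)..n, g x = n * ∫ x in (0:ℝ)..1, g x := by
    intro n
    simpa using hper.intervalIntegral_add_zsmul_eq n 0 hint
  have hlow := hmono (Int.floor_le y)
  have hupp := hmono (Int.lt_floor_add_one y).le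
  have hZ_succ := hZ (⌊y⌋ + 1)
  push_cast at hZ_succ
  rw [hZ] at hlow
  rw [hZ_succ] at hupp
  have hlow' := mul_le_mul_of_nonneg_right (Int.floor_le y) hA.le
  have hupp' := mul_le_mul_of_nonneg_right (Int.lt_floor_add_one y).le hA.le
  rw [abs_le]
  constructor <;> linarith

/-- Separation of variables for `ξ' = F(ξ)` on the negative half-line. -/
theorem integral_inv_eq_of_hasDerivAt {F : ℝ → ℝ} (hF : Continuous F) (hpos : ∀ x, 0 < F x)
    {ξ : ℝ → ℝ} (hξ0 : ξ 0 = 0) (hξ : ∀ t : ℝ, t ≤ 0 → HasDerivAt ξ (F (ξ t)) t)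
    {t : ℝ} (ht : t ≤ 0) : ∫ x in (0:ℝ)..ξ t, (F x)⁻¹ = t := by
  have hg : Continuous fun x => (F x)⁻¹ := hF.inv₀ fun x => (hpos x).ne'
  have hderiv : ∀ s ∈ Set.uIcc t 0,
      HasDerivAt (fun s => ∫ x in (0:ℝ)..ξ s, (F x)⁻¹) 1 s := by
    intro s hs
    rw [Set.uIcc_of_le ht] at hs
    have h := (hg.integral_hasStrictDerivAt 0 (ξ s)).hasDerivAt.comp s (hξ s hs.2)
    rwa [inv_mul_cancel₀ (hpos _).ne'] at h
  have h := intervalIntegral.integral_eq_sub_of_hasDerivAt hderiv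
    intervalIntegrable_const
  simp only [intervalIntegral.integral_const, smul_eq_mul, hξ0,
    intervalIntegral.integral_same] at h
  linarith

theorem stmt17 (F : ℝ → ℝ) (hFcont : Continuous F) (hFper : Function.Periodic F 1)
    (hFpos : ∀ x, 0 < F x) (A : ℝ) (hA : A = ∫ x in (0:ℝ)..1, (F x)⁻¹)
    (ξ : ℝ → ℝ) (hξ0 : ξ 0 = 0)
    (hξ : ∀ t : ℝ, t ≤ 0 → HasDerivAt ξ (F (ξ t)) t) :
    ∀ t : ℝ, t < 0 → |ξ t / t - A⁻¹| ≤ 1 / |t| := by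
  intro t ht
  have hg : Continuous fun x => (F x)⁻¹ := hFcont.inv₀ fun x => (hFpos x).ne'
  have hApos : 0 < A := by
    rw [hA]
    exact intervalIntegral.intervalIntegral_pos_of_pos (hg.intervalIntegrable 0 1)
      (fun x => inv_pos.2 (hFpos x)) one_pos
  have hbound := abs_integral_sub_mul_le_of_periodic hg
    (fun x => congrArg (·⁻¹) (hFper x)) (fun x => inv_pos.2 (hFpos x)) (ξ t)
  rw [integral_inv_eq_of_hasDerivAt hFcont hFpos hξ0 hξ ht.le, ← hA, abs_sub_comm] at hbound
  have heq : ξ t / t - A⁻¹ = (ξ t * A - t) / (A * t) := by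
    field_simp [ht.ne, hApos.ne']
  rw [heq, abs_div, abs_mul, abs_of_pos hApos,
    div_le_div_iff₀ (mul_pos hApos (abs_pos.2 ht.ne)) (abs_pos.2 ht.ne), one_mul]
  exact mul_le_mul_of_nonneg_right hbound (abs_nonneg t)
end
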